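/- Let f ∈ ℂ[X] with deg f > 1, and let (u_1,…,u_r) and (v_1,…,v_s) be two complete decompositions of f. Then r = s, and there is a permutation χ of {1,2,…,r} such that for every 1 ≤ i ≤ r the monodromy groups Mon(u_i) and Mon(v_{χ(i)}) are isomorphic as permutation groups. -/

import Mathlib

open Polynomial

/-- A polynomial `u ∈ ℂ[X]` is indecomposable if `deg u > 1` and `u` is not the
composition of two polynomials each of degree strictly less than `deg u`. -/
def Indecomposable (u : ℂ[X]) : Prop :=
  1 < u.natDegree ∧
    ¬ ∃ g h : ℂ[X], g.natDegree < u.natDegree ∧ h.natDegree < u.natDegree ∧ u = g.comp h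

/-- The composition `u_1 ∘ u_2 ∘ ⋯ ∘ u_r` of a list of polynomials. -/
noncomputable def compList (L : List ℂ[X]) : ℂ[X] :=
  L.foldr Polynomial.comp Polynomial.X

/-- A complete decomposition of `f` is a finite sequence of indecomposable
polynomials whose composition is `f`. -/
def CompleteDecomp (f : ℂ[X]) (L : List ℂ[X]) : Prop :=
  (∀ u ∈ L, Indecomposable u) ∧ f = compList L

/-- The polynomial `u(X) - t` over the rational function field `ℂ(t)`. -/
noncomputable def monPoly (u : ℂ[X]) : Polynomial (RatFunc ℂ) :=
  u.map (RatFunc.C) - Polynomial.C RatFunc.X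

/-- `Mon(u)` and `Mon(v)` are isomorphic as permutation groups: there are a group
isomorphism and a compatible bijection between the corresponding root sets. -/
def MonPermIso (u v : ℂ[X]) : Prop :=
  ∃ (φ : (monPoly u).Gal ≃* (monPoly v).Gal)
    (ψ : (monPoly u).rootSet (monPoly u).SplittingField ≃
         (monPoly v).rootSet (monPoly v).SplittingField),
    ∀ (τ : (monPoly u).Gal) (ω : (monPoly u).rootSet (monPoly u).SplittingField),
      ψ (τ • ω) = φ τ • ψ ω

section Groups

/-- Two group actions have isomorphic images as permutation groups. -/
def SameImage (G X G' X' : Type*) [Group G] [MulAction G X] [Group G'] [MulAction G' X'] : Prop :=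
  ∃ ψ : X ≃ X', (∀ g : G, ∃ g' : G', ∀ x, ψ (g • x) = g' • ψ x) ∧
    ∀ g' : G', ∃ g : G, ∀ x, ψ (g • x) = g' • ψ x

namespace SameImage

variable {G X G' X' G'' X'' : Type*} [Group G] [MulAction G X] [Group G'] [MulAction G' X']
  [Group G''] [MulAction G'' X'']

theorem refl : SameImage G X G X :=
  ⟨Equiv.refl X, fun g => ⟨g, fun _ => rfl⟩, fun g => ⟨g, fun _ => rfl⟩⟩

theorem symm (h : SameImage G X G' X') : SameImage G' X' G X := by
  obtain ⟨ψ, h₁, h₂⟩ := h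
  refine ⟨ψ.symm, fun g' => ?_, fun g => ?_⟩
  · obtain ⟨g, hg⟩ := h₂ g'
    exact ⟨g, fun x => by rw [Equiv.symm_apply_eq, hg, Equiv.apply_symm_apply]⟩
  · obtain ⟨g', hg⟩ := h₁ g
    exact ⟨g', fun x => by rw [Equiv.symm_apply_eq, hg, Equiv.apply_symm_apply]⟩

theorem trans (h : SameImage G X G' X') (h' : SameImage G' X' G'' X'') :
    SameImage G X G'' X'' := by
  obtain ⟨ψ, h₁, h₂⟩ := h
  obtain ⟨ψ', h₁', h₂'⟩ := h'
  refine ⟨ψ.trans ψ', fun g => ?_, fun g'' => ?_⟩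
  · obtain ⟨g', hg⟩ := h₁ g
    obtain ⟨g'', hg'⟩ := h₁' g'
    exact ⟨g'', fun x => by simp [hg, hg']⟩
  · obtain ⟨g', hg'⟩ := h₂' g''
    obtain ⟨g, hg⟩ := h₂ g'
    exact ⟨g, fun x => by simp [hg, hg']⟩

/-- For faithful actions, having the same image is being isomorphic as permutation groups. -/
theorem exists_mulEquiv [FaithfulSMul G X] [FaithfulSMul G' X'] (h : SameImage G X G' X') :
    ∃ (φ : G ≃* G') (ψ : X ≃ X'), ∀ g x, ψ (g • x) = φ g • ψ x := by
  obtain ⟨ψ, h₁, h₂⟩ := h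
  choose φ hφ using h₁
  have hinj : Function.Injective φ := fun a b hab =>
    FaithfulSMul.eq_of_smul_eq_smul (α := X) fun x => ψ.injective (by rw [hφ, hφ, hab])
  have hsurj : Function.Surjective φ := fun g' => by
    obtain ⟨g, hg⟩ := h₂ g'
    refine ⟨g, FaithfulSMul.eq_of_smul_eq_smul (α := X') fun x' => ?_⟩
    obtain ⟨x, rfl⟩ := ψ.surjective x'
    rw [← hφ, hg]
  have hmul : ∀ a b, φ (a * b) = φ a * φ b := fun a b =>
    FaithfulSMul.eq_of_smul_eq_smul (α := X') fun x' => by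
      obtain ⟨x, rfl⟩ := ψ.surjective x'
      rw [← hφ, mul_smul, mul_smul, hφ, hφ]
  exact ⟨MulEquiv.mk (Equiv.ofBijective φ ⟨hinj, hsurj⟩) hmul, ψ, hφ⟩

/-- A transitive action has the same image as the action on the cosets of a point stabilizer. -/
theorem quotient_of_transitive (x : X) (S : Subgroup G) (hS : ∀ g, g ∈ S ↔ g • x = x)
    (htrans : ∀ z : X, ∃ g : G, g • x = z) : SameImage G (G ⧸ S) G X := by
  obtain rfl : S = MulAction.stabilizer G x := by ext g; exact hS g
  have : MulAction.IsPretransitive G X := ⟨fun a b => by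
    obtain ⟨g, rfl⟩ := htrans a
    obtain ⟨g', rfl⟩ := htrans b
    exact ⟨g' * g⁻¹, by simp [mul_smul]⟩⟩
  let ψ : G ⧸ MulAction.stabilizer G x ≃ X := Equiv.ofBijective
    (MulAction.ofQuotientStabilizer G x)
    ⟨MulAction.injective_ofQuotientStabilizer G x, fun z => by
      obtain ⟨g, rfl⟩ := htrans z
      exact ⟨g, rfl⟩⟩
  have hψ : ∀ (g : G) z, ψ (g • z) = g • ψ z := MulAction.ofQuotientStabilizer_smul G x
  exact ⟨ψ, fun g => ⟨g, hψ g⟩, fun g => ⟨g, hψ g⟩⟩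

end SameImage

namespace Subgroup

variable {G : Type*} [Group G] {H : Subgroup G} {I : Set G}

/-- If `G = H I` with the elements of `I` commuting, then any two subgroups containing `H`
permute. -/
theorem mem_sup_iff_of_factorization (hI : ∀ i ∈ I, ∀ j ∈ I, Commute i j)
    (hG : ∀ g : G, ∃ h ∈ H, ∃ i ∈ I, g = h * i) (hG' : ∀ g : G, ∃ i ∈ I, ∃ h ∈ H, g = i * h)
    {A B : Subgroup G} (hA : H ≤ A) (hB : H ≤ B) {g : G} :
    g ∈ A ⊔ B ↔ ∃ a ∈ A, ∃ b ∈ B, g = a * b := by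
  constructor
  · have swap : ∀ b ∈ B, ∀ a ∈ A, ∃ a' ∈ A, ∃ b' ∈ B, b * a = a' * b' := by
      intro b hb a ha
      obtain ⟨h, hh, i, hi, rfl⟩ := hG b
      obtain ⟨j, hj, k, hk, rfl⟩ := hG' a
      have hiB : i ∈ B := (B.mul_mem_cancel_left (hB hh)).1 hb
      have hjA : j ∈ A := (A.mul_mem_cancel_right (hA hk)).1 ha
      refine ⟨h * j, A.mul_mem (hA hh) hjA, i * k, B.mul_mem hiB (hB hk), ?_⟩
      calc h * i * (j * k) = h * (i * j) * k := by group
        _ = h * j * (i * k) := by rw [(hI i hi j hj).eq]; group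
    let P : Subgroup G :=
      { carrier := {g | ∃ a ∈ A, ∃ b ∈ B, g = a * b}
        one_mem' := ⟨1, A.one_mem, 1, B.one_mem, by simp⟩
        mul_mem' := by
          rintro _ _ ⟨a, ha, b, hb, rfl⟩ ⟨c, hc, d, hd, rfl⟩
          obtain ⟨c', hc', b', hb', e⟩ := swap b hb c hc
          refine ⟨a * c', A.mul_mem ha hc', b' * d, B.mul_mem hb' hd, ?_⟩
          calc a * b * (c * d) = a * (b * c) * d := by group
            _ = a * c' * (b' * d) := by rw [e]; group
        inv_mem' := by
          rintro _ ⟨a, ha, b, hb, rfl⟩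
          rw [mul_inv_rev]
          exact swap _ (B.inv_mem hb) _ (A.inv_mem ha) }
    have hP : A ⊔ B ≤ P := sup_le (fun a ha => ⟨a, ha, 1, B.one_mem, by simp⟩)
      fun b hb => ⟨1, A.one_mem, b, hb, by simp⟩
    exact fun hg => hP hg
  · rintro ⟨a, ha, b, hb, rfl⟩
    exact mul_mem (le_sup_left (b := B) ha) (le_sup_right (a := A) hb)

theorem isModularLattice_Ici_of_factorization (hI : ∀ i ∈ I, ∀ j ∈ I, Commute i j)
    (hG : ∀ g : G, ∃ h ∈ H, ∃ i ∈ I, g = h * i) (hG' : ∀ g : G, ∃ i ∈ I, ∃ h ∈ H, g = i * h) :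
    IsModularLattice (Set.Ici H) where
  sup_inf_le_assoc_of_le {x} y {z} hxz := by
    intro g hg
    obtain ⟨hg₁, hg₂⟩ : g ∈ (x : Subgroup G) ⊔ y ∧ g ∈ (z : Subgroup G) := hg
    obtain ⟨a, ha, b, hb, rfl⟩ := (mem_sup_iff_of_factorization hI hG hG' x.2 y.2).1 hg₁
    have hbz : b ∈ (z : Subgroup G) := (mul_mem_cancel_left (hxz ha)).1 hg₂
    exact mul_mem (le_sup_left (a := x) (b := y ⊓ z) ha)
      (le_sup_right (a := x) (b := y ⊓ z) (show b ∈ (y : Subgroup G) ⊓ z from ⟨hb, hbz⟩))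

/-- If `G = H I` with the elements of `I` commuting, then for subgroups `A`, `B` containing `H`,
the actions of `A ⊔ B` on the cosets of `A` and of `B` on the cosets of `A ⊓ B` have the same
image. -/
theorem sameImage_sup_inf_of_factorization (hI : ∀ i ∈ I, ∀ j ∈ I, Commute i j)
    (hG : ∀ g : G, ∃ h ∈ H, ∃ i ∈ I, g = h * i) (hG' : ∀ g : G, ∃ i ∈ I, ∃ h ∈ H, g = i * h)
    {A B : Subgroup G} (hA : H ≤ A) (hB : H ≤ B) :
    SameImage (A ⊔ B : Subgroup G) ((A ⊔ B : Subgroup G) ⧸ A.subgroupOf (A ⊔ B))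
      B (B ⧸ (A ⊓ B).subgroupOf B) := by
  apply SameImage.symm
  have hBle : B ≤ A ⊔ B := le_sup_right
  have hfac : ∀ w ∈ A ⊔ B, ∃ b ∈ B, ∃ a ∈ A, w = b * a := fun w hw =>
    (mem_sup_iff_of_factorization hI hG hG' hB hA).1 (by rwa [sup_comm])
  let f : B ⧸ (A ⊓ B).subgroupOf B → (A ⊔ B : Subgroup G) ⧸ A.subgroupOf (A ⊔ B) :=
    Quotient.map' (inclusion hBle) fun b c h => by
      rw [QuotientGroup.leftRel_apply, mem_subgroupOf] at h ⊢
      exact h.1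
  have hf : ∀ b : B, f (b : B ⧸ _) = ((inclusion hBle b : (A ⊔ B : Subgroup G)) :
    (A ⊔ B : Subgroup G) ⧸ A.subgroupOf (A ⊔ B)) := fun b => rfl
  have hbij : Function.Bijective f := by
    constructor
    · rintro ⟨b⟩ ⟨c⟩ h
      have h' := QuotientGroup.eq.1 h
      exact QuotientGroup.eq.2 ⟨h', (b⁻¹ * c).2⟩
    · rintro ⟨w, hw⟩
      obtain ⟨b, hb, a, ha, rfl⟩ := hfac w hw
      refine ⟨((⟨b, hb⟩ : B) : B ⧸ _), (hf _).trans (QuotientGroup.eq.2 ?_)⟩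
      rw [mem_subgroupOf]
      simpa using ha
  have hequiv : ∀ (b : B) z, f (b • z) = inclusion hBle b • f z := by
    rintro b ⟨c⟩
    rfl
  refine ⟨Equiv.ofBijective f hbij, fun b => ⟨inclusion hBle b, hequiv b⟩, ?_⟩
  rintro ⟨w, hw⟩
  obtain ⟨b, hb, a, ha, rfl⟩ := hfac w hw
  obtain ⟨h, hh, i, hi, rfl⟩ := hG a
  have hiA : i ∈ A := (A.mul_mem_cancel_left (hA hh)).1 ha
  refine ⟨⟨b * h, B.mul_mem hb (hB hh)⟩, fun z => ?_⟩
  refine (hequiv _ z).trans ?_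
  change _ • f z = _ • f z
  generalize f z = z'
  obtain ⟨⟨v, hv⟩, rfl⟩ := QuotientGroup.mk_surjective z'
  obtain ⟨j, hj, k, hk, rfl⟩ := hG' v
  refine QuotientGroup.eq.2 ?_
  rw [mem_subgroupOf]
  change (b * h * (j * k))⁻¹ * (b * (h * i) * (j * k)) ∈ A
  have : (b * h * (j * k))⁻¹ * (b * (h * i) * (j * k)) = k⁻¹ * i * k := by
    calc _ = k⁻¹ * j⁻¹ * (i * j) * k := by group
      _ = k⁻¹ * i * k := by rw [(hI i hi j hj).eq]; group
  rw [this]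
  exact A.mul_mem (A.mul_mem (A.inv_mem (hA hk)) hiA) (hA hk)

end Subgroup

end Groups

section Luroth

open IntermediateField algebraAdjoinAdjoin

namespace RatFunc

variable {K : Type*} [Field K]

theorem exists_coeff_minpoly_ne_C {E : IntermediateField K K⟮X⟯} (hE : E ≠ ⊥) :
    ∃ i, ¬ ∃ c, (((minpoly E (X : K⟮X⟯)).coeff i : E) : K⟮X⟯) = C c := by
  by_contra! hcon
  have hmem : minpoly E (X : K⟮X⟯) ∈ (Polynomial.mapRingHom (algebraMap K E)).range := by
    rw [mem_map_range]
    intro i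
    obtain ⟨c, hc⟩ := hcon i
    exact ⟨c, Subtype.ext hc.symm⟩
  obtain ⟨p, hp⟩ := hmem
  rw [coe_mapRingHom] at hp
  refine transcendental_X ⟨p, ?_, ?_⟩
  · rintro rfl
    exact minpoly.ne_zero (IntermediateField.isAlgebraic_X hE).isIntegral (by simpa using hp.symm)
  · simpa using congrArg (aeval (X : K⟮X⟯)) hp

/-- An intermediate field of `K(X)/K` containing a nonconstant polynomial is generated by a
polynomial. -/
theorem exists_eq_adjoin_polynomial (E : IntermediateField K K⟮X⟯) {u : K[X]}
    (hu : 0 < u.natDegree) (huE : algebraMap K[X] K⟮X⟯ u ∈ E) :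
    ∃ h : K[X], E = K⟮algebraMap K[X] K⟮X⟯ h⟯ := by
  obtain ⟨g, rfl⟩ : ∃ g, E = K⟮g⟯ := ⟨_, Luroth.eq_adjoin_generator⟩
  have huC : ¬ ∃ c, algebraMap K[X] K⟮X⟯ u = C c := by
    rintro ⟨c, hc⟩
    rw [← algebraMap_C] at hc
    rw [algebraMap_injective K hc, natDegree_C] at hu
    exact lt_irrefl _ hu
  have hE : K⟮g⟯ ≠ ⊥ := by
    intro h
    rw [h, IntermediateField.mem_bot] at huE
    obtain ⟨c, hc⟩ := huE
    exact huC ⟨c, hc.symm⟩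
  have hg : ¬ ∃ c, g = C c := by
    rintro ⟨c, rfl⟩
    exact hE (adjoin_simple_eq_bot_iff.mpr ⟨c, rfl⟩)
  have hmonic : (minpoly K⟮g⟯ (X : K⟮X⟯)).Monic :=
    minpoly.monic (IntermediateField.isAlgebraic_X hE).isIntegral
  obtain ⟨i, hi⟩ := exists_coeff_minpoly_ne_C hE
  set c : K⟮g⟯ := (minpoly K⟮g⟯ (X : K⟮X⟯)).coeff i with hc
  have hint : ∃ h : K[X], algebraMap K[X] K⟮X⟯ h = c := by
    rw [← IsIntegrallyClosed.isIntegral_iff]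
    have hdvd : minpoly K⟮g⟯ (X : K⟮X⟯) ∣ u.map (algebraMap K K⟮g⟯) - Polynomial.C ⟨_, huE⟩ := by
      apply minpoly.dvd
      simp [aeval_X_left_eq_algebraMap]
    have hlc : u.leadingCoeff ≠ 0 := by
      rw [Ne, leadingCoeff_eq_zero]
      rintro rfl
      simp at hu
    let P : K[X][X] := Polynomial.C (Polynomial.C u.leadingCoeff⁻¹) *
      (u.map Polynomial.C - Polynomial.C u)
    have hP : P.Monic := by
      have hdeg : (Polynomial.C u : K[X][X]).degree <
          (u.map (Polynomial.C : K →+* K[X])).degree := by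
        rw [degree_map]
        exact degree_C_le.trans_lt (natDegree_pos_iff_degree_pos.1 hu)
      rw [Monic, leadingCoeff_mul, leadingCoeff_sub_of_degree_lt hdeg, leadingCoeff_C,
        leadingCoeff_map, ← map_mul, inv_mul_cancel₀ hlc, map_one]
    rw [show (c : K⟮X⟯) = ((minpoly K⟮g⟯ (X : K⟮X⟯)).map (algebraMap K⟮g⟯ K⟮X⟯)).coeff i by
      rw [coeff_map]; rfl]
    refine isIntegral_coeff_of_dvd P _ hP (hmonic.map _) ?_ i
    have := Polynomial.map_dvd (algebraMap K⟮g⟯ K⟮X⟯) hdvd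
    simp only [P, Polynomial.map_mul, Polynomial.map_sub, Polynomial.map_map, Polynomial.map_C]
      at this ⊢
    exact Dvd.dvd.mul_left this _
  obtain ⟨h, hh⟩ := hint
  refine ⟨h, le_antisymm ?_ ?_⟩
  · rw [adjoin_simple_le_iff]
    rw [hh]
    have hmin : minpoly K⟮g⟯ (X : K⟮X⟯) = g.minpolyX K⟮g⟯ *
        Polynomial.C (g.minpolyX K⟮g⟯).leadingCoeff⁻¹ :=
      (minpoly.eq_of_irreducible (g.irreducible_minpolyX hg) g.minpolyX_aeval_X).symm
    have hcoeff : ∀ j, (((g.minpolyX K⟮g⟯).coeff j : K⟮g⟯) : K⟮X⟯)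
        = C (g.num.coeff j) - g * C (g.denom.coeff j) := fun j => by
      simp [minpolyX]
    have hlead : (g.minpolyX K⟮g⟯).leadingCoeff ≠ 0 := by
      rw [Ne, leadingCoeff_eq_zero]
      exact fun h => hg ((minpolyX_eq_zero_iff g).1 h)
    set n := (g.minpolyX K⟮g⟯).natDegree with hn
    have hrel : (c : K⟮X⟯) * (C (g.num.coeff n) - g * C (g.denom.coeff n)) =
        C (g.num.coeff i) - g * C (g.denom.coeff i) := by
      rw [← hcoeff, ← hcoeff, ← MulMemClass.coe_mul, hc, hmin, coeff_mul_C, mul_assoc]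
      rw [show (g.minpolyX K⟮g⟯).coeff n = (g.minpolyX K⟮g⟯).leadingCoeff from rfl,
        inv_mul_cancel₀ hlead, mul_one]
    have hlead' : C (g.num.coeff n) - g * C (g.denom.coeff n) ≠ 0 := by
      rw [← hcoeff]
      exact fun h => hlead (Subtype.ext h)
    have hne : C (g.denom.coeff i) - c * C (g.denom.coeff n) ≠ 0 := by
      intro h0
      by_cases hd : g.denom.coeff n = 0
      · have hd' : g.denom.coeff i = 0 := by
          rw [hd] at h0
          exact C_injective (by simpa using h0)
        rw [hd, hd', map_zero, mul_zero, sub_zero, sub_zero] at hrel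
        rw [hd, map_zero, mul_zero, sub_zero] at hlead'
        exact hi ⟨g.num.coeff i / g.num.coeff n, by rw [map_div₀, eq_div_iff hlead', hrel]⟩
      · refine hi ⟨g.denom.coeff i / g.denom.coeff n, ?_⟩
        rw [map_div₀, eq_div_iff ((_root_.map_ne_zero C).2 hd), eq_comm, ← sub_eq_zero, h0]
    have hgeq : g = (C (g.num.coeff i) - c * C (g.num.coeff n)) /
        (C (g.denom.coeff i) - c * C (g.denom.coeff n)) := by
      rw [eq_div_iff hne]
      linear_combination hrel
    have hcm : (c : K⟮X⟯) ∈ K⟮(c : K⟮X⟯)⟯ := mem_adjoin_simple_self _ _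
    have hCm : ∀ a : K, C a ∈ K⟮(c : K⟮X⟯)⟯ := fun a => _root_.algebraMap_mem _ a
    have hmem := div_mem (sub_mem (hCm (g.num.coeff i)) (mul_mem hcm (hCm (g.num.coeff n))))
      (sub_mem (hCm (g.denom.coeff i)) (mul_mem hcm (hCm (g.denom.coeff n))))
    rwa [← hgeq] at hmem
  · rw [adjoin_simple_le_iff, hh]
    exact c.2

/-- A polynomial in `K(h)`, with `h` a nonconstant polynomial, is a polynomial in `h`. -/
theorem exists_eq_comp_of_mem_adjoin {u h : K[X]} (hh : h.natDegree ≠ 0)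
    (hu : algebraMap K[X] K⟮X⟯ u ∈ K⟮algebraMap K[X] K⟮X⟯ h⟯) : ∃ g : K[X], u = g.comp h := by
  have key : ∀ p : K[X], aeval (algebraMap K[X] K⟮X⟯ h) p = algebraMap K[X] K⟮X⟯ (p.comp h) := by
    intro p
    rw [aeval_algebraMap_apply, comp_eq_aeval]
  have hcomp : ∀ p : K[X], p.comp h = 0 → p = 0 := fun p hp => by
    rcases comp_eq_zero_iff.1 hp with h0 | ⟨-, h0⟩
    · exact h0
    · rw [h0, natDegree_C] at hh
      exact absurd rfl hh
  have htr : Transcendental K (algebraMap K[X] K⟮X⟯ h) := by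
    rw [transcendental_iff]
    intro p hp
    rw [key, map_eq_zero_iff _ (algebraMap_injective K)] at hp
    exact hcomp p hp
  obtain ⟨r, hr⟩ := (algEquivOfTranscendental _ htr).surjective ⟨_, hu⟩
  have hr' := congrArg Subtype.val hr
  rw [algEquivOfTranscendental_apply, key, key] at hr'
  have hden : r.denom.comp h ≠ 0 := fun h0 => r.denom_ne_zero (hcomp _ h0)
  have hmul : r.num.comp h = u * r.denom.comp h := by
    apply algebraMap_injective K
    rw [map_mul]
    exact (div_eq_iff (algebraMap_ne_zero hden)).1 hr'
  obtain ⟨a, b, hab⟩ := r.isCoprime_num_denom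
  have hunit : IsUnit (r.denom.comp h) := by
    refine IsUnit.of_mul_eq_one (a.comp h * u + b.comp h) ?_
    have := congrArg (fun p => Polynomial.comp p h) hab
    simp only [add_comp, mul_comp, one_comp, hmul] at this
    linear_combination this
  have hdeg : r.denom.natDegree = 0 := by
    have := natDegree_eq_zero_of_isUnit hunit
    rw [natDegree_comp] at this
    exact (mul_eq_zero.1 this).resolve_right hh
  have hone : r.denom = 1 := r.monic_denom.natDegree_eq_zero.1 hdeg
  exact ⟨r.num, by rw [hmul, hone, one_comp, mul_one]⟩

end RatFunc

theorem Polynomial.adjoin_aeval_eq_of_natDegree_eq_one {K L : Type*} [Field K] [Field L]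
    [Algebra K L] {a : K[X]} (ha : a.natDegree = 1) (x : L) : K⟮aeval x a⟯ = K⟮x⟯ := by
  apply le_antisymm
  · rw [adjoin_simple_le_iff]
    exact (mem_adjoin_simple_iff K _).2 ⟨a, 1, by simp⟩
  · rw [adjoin_simple_le_iff]
    obtain ⟨b, c, hb, rfl⟩ : ∃ b c : K, b ≠ 0 ∧ a = C b * X + C c :=
      ⟨a.coeff 1, a.coeff 0, by
        rw [← ha, coeff_natDegree, Ne, leadingCoeff_eq_zero]
        rintro rfl
        simp at ha, eq_X_add_C_of_natDegree_le_one ha.le⟩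
    have hx : x = (aeval x (C b * X + C c) - algebraMap K L c) / algebraMap K L b := by
      rw [eq_div_iff ((_root_.map_ne_zero _).2 hb)]
      simp only [map_add, map_mul, aeval_C, aeval_X]
      ring
    have hmem : _ ∈ K⟮aeval x (C b * X + C c)⟯ := div_mem
      (sub_mem (mem_adjoin_simple_self K _) (_root_.algebraMap_mem _ c))
      (_root_.algebraMap_mem _ b)
    rwa [← hx] at hmem

end Luroth

section Irreducible

theorem monPoly_eq_map (u : ℂ[X]) :
    monPoly u = (u.map C - C X : ℂ[X][X]).map (algebraMap ℂ[X] (RatFunc ℂ)) := by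
  simp only [monPoly, Polynomial.map_sub, Polynomial.map_map, Polynomial.map_C,
    RatFunc.algebraMap_comp_C, RatFunc.algebraMap_X]

theorem natDegree_monPoly (u : ℂ[X]) : (monPoly u).natDegree = u.natDegree := by
  rw [monPoly, natDegree_sub_C, natDegree_map]

theorem irreducible_monPoly {u : ℂ[X]} (hu : 0 < u.natDegree) : Irreducible (monPoly u) := by
  have hirr : Irreducible (u.map C - C X : ℂ[X][X]) := by
    have hswap : (u.map C - C X : ℂ[X][X]) = Bivariate.swap (C (-1) * X + C u) := by
      rw [map_add, map_mul, Bivariate.swap_Y, Bivariate.swap_C, Bivariate.swap_C,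
        Polynomial.map_neg, Polynomial.map_one]
      ring
    rw [hswap, MulEquiv.irreducible_iff]
    exact irreducible_C_mul_X_add_C (by simp) isUnit_one.neg.isRelPrime_left
  have hdeg : (u.map C - C X : ℂ[X][X]).natDegree ≠ 0 := by
    rw [natDegree_sub_C, natDegree_map]
    exact hu.ne'
  rw [monPoly_eq_map]
  exact ((hirr.isPrimitive hdeg).irreducible_iff_irreducible_map_fraction_map).1 hirr

theorem aeval_monPoly {Ω : Type*} [Field Ω] [Algebra (RatFunc ℂ) Ω] [Algebra ℂ Ω]
    [IsScalarTower ℂ (RatFunc ℂ) Ω] (u : ℂ[X]) (y : Ω) :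
    aeval y (monPoly u) = aeval y u - algebraMap (RatFunc ℂ) Ω RatFunc.X := by
  rw [monPoly, map_sub, aeval_C, ← RatFunc.algebraMap_eq_C, aeval_map_algebraMap]

end Irreducible

section Puiseux

open scoped PowerSeries

/-- Solving `f = lc(f) s⁻ᴺ` by a power series in `s`, up to a factor `s⁻¹`. -/
theorem exists_powerSeries_root {f : ℂ[X]} (hf : 0 < f.natDegree) :
    ∃ Y : ℂ⟦X⟧, PowerSeries.constantCoeff Y = 1 ∧
      aeval (algebraMap ℂ⟦X⟧ (FractionRing ℂ⟦X⟧) Y /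
          algebraMap ℂ⟦X⟧ (FractionRing ℂ⟦X⟧) PowerSeries.X) f =
        algebraMap ℂ (FractionRing ℂ⟦X⟧) f.leadingCoeff /
          algebraMap ℂ⟦X⟧ (FractionRing ℂ⟦X⟧) PowerSeries.X ^ f.natDegree := by
  have hf0 : f ≠ 0 := by rintro rfl; simp at hf
  have hlc : f.leadingCoeff ≠ 0 := leadingCoeff_ne_zero.2 hf0
  set g : ℂ[X] := f * Polynomial.C f.leadingCoeff⁻¹ with hg
  have hgm : g.Monic := monic_mul_leadingCoeff_inv hf0
  have hgdeg : g.natDegree = f.natDegree := natDegree_mul_leadingCoeff_inv f hf0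
  set Q : ℂ⟦X⟧[X] := scaleRoots (g.map (algebraMap ℂ ℂ⟦X⟧)) PowerSeries.X with hQ
  have hQm : Q.Monic := (monic_scaleRoots_iff _).2 (hgm.map _)
  have hQdeg : Q.natDegree = f.natDegree := by rw [hQ, natDegree_scaleRoots, natDegree_map, hgdeg]
  have hQmap : Q.map PowerSeries.constantCoeff = Polynomial.X ^ f.natDegree := by
    rw [hQ, map_scaleRoots _ _ _ (by rw [(hgm.map _).leadingCoeff]; simp),
      PowerSeries.constantCoeff_X,
      scaleRoots_zero, Polynomial.map_map, ((hgm.map _)).leadingCoeff, natDegree_map, hgdeg,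
      one_smul]
  have hPm : (Q - 1).Monic := hQm.sub_of_left (by
    rw [degree_one]
    exact natDegree_pos_iff_degree_pos.1 (hQdeg ▸ hf))
  have hmem : ∀ a : ℂ⟦X⟧, a ∈ Ideal.span {(PowerSeries.X : ℂ⟦X⟧)} ↔
      PowerSeries.constantCoeff a = 0 := fun a => by
    rw [Ideal.mem_span_singleton, PowerSeries.X_dvd_iff]
  have hroot : Polynomial.eval 1 (Q - 1) ∈ Ideal.span {(PowerSeries.X : ℂ⟦X⟧)} := by
    rw [hmem, ← Polynomial.eval_map_apply, Polynomial.map_sub, hQmap]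
    simp
  have hder : IsUnit (Ideal.Quotient.mk (Ideal.span {(PowerSeries.X : ℂ⟦X⟧)})
      (Polynomial.eval 1 (derivative (Q - 1)))) := by
    apply IsUnit.map
    rw [PowerSeries.isUnit_iff_constantCoeff, ← Polynomial.eval_map_apply, ← derivative_map,
      Polynomial.map_sub, hQmap, Polynomial.map_one, derivative_sub, derivative_X_pow]
    simp [hf.ne']
  obtain ⟨Y, hY, hY1⟩ := HenselianRing.is_henselian (I := Ideal.span {(PowerSeries.X : ℂ⟦X⟧)})
    (Q - 1) hPm 1 hroot hder
  refine ⟨Y, ?_, ?_⟩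
  · rw [hmem, map_sub, map_one, sub_eq_zero] at hY1
    exact hY1
  set s := algebraMap ℂ⟦X⟧ (FractionRing ℂ⟦X⟧) PowerSeries.X with hs
  have hs0 : s ≠ 0 := by
    rw [hs, Ne, FaithfulSMul.algebraMap_eq_zero_iff]
    exact PowerSeries.X_ne_zero
  have hQY : Polynomial.eval Y Q = 1 := by
    have : Polynomial.eval Y (Q - 1) = 0 := hY
    simpa [sub_eq_zero] using this
  have key := scaleRoots_eval₂_mul (p := g.map (algebraMap ℂ ℂ⟦X⟧))
    (algebraMap ℂ⟦X⟧ (FractionRing ℂ⟦X⟧)) (algebraMap ℂ⟦X⟧ (FractionRing ℂ⟦X⟧) Y / s) PowerSeries.X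
  rw [← hs, mul_div_cancel₀ _ hs0, ← hQ, eval₂_at_apply, hQY, map_one, eval₂_map,
    ← IsScalarTower.algebraMap_eq, natDegree_map, hgdeg, ← aeval_def, hg, map_mul, aeval_C,
    map_inv₀] at key
  rw [eq_div_iff (pow_ne_zero _ hs0), mul_comm]
  have hlc' : algebraMap ℂ (FractionRing ℂ⟦X⟧) f.leadingCoeff ≠ 0 := (_root_.map_ne_zero _).2 hlc
  rw [← mul_assoc, ← div_eq_mul_inv, eq_div_iff hlc', one_mul] at key
  exact key.symm

theorem PowerSeries.rescaleAlgHom_apply {R : Type*} [CommRing R] (a : R) (g : R⟦X⟧) :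
    PowerSeries.rescaleAlgHom a g = PowerSeries.rescale a g :=
  DFunLike.congr_fun (PowerSeries.coe_rescaleAlgHom a) g

/-- Rescaling of the variable by a nonzero constant, as an automorphism of power series. -/
noncomputable def PowerSeries.rescaleAlgEquiv {K : Type*} [Field K] (a : K) (ha : a ≠ 0) :
    K⟦X⟧ ≃ₐ[K] K⟦X⟧ :=
  AlgEquiv.ofAlgHom (PowerSeries.rescaleAlgHom a) (PowerSeries.rescaleAlgHom a⁻¹)
    (AlgHom.ext fun g => by
      rw [AlgHom.comp_apply, PowerSeries.rescaleAlgHom_apply, PowerSeries.rescaleAlgHom_apply,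
        PowerSeries.rescale_rescale, inv_mul_cancel₀ ha, PowerSeries.rescale_one]
      rfl)
    (AlgHom.ext fun g => by
      rw [AlgHom.comp_apply, PowerSeries.rescaleAlgHom_apply, PowerSeries.rescaleAlgHom_apply,
        PowerSeries.rescale_rescale, mul_inv_cancel₀ ha, PowerSeries.rescale_one]
      rfl)

theorem PowerSeries.rescaleAlgEquiv_apply {K : Type*} [Field K] (a : K) (ha : a ≠ 0) (g : K⟦X⟧) :
    PowerSeries.rescaleAlgEquiv a ha g = PowerSeries.rescale a g :=
  PowerSeries.rescaleAlgHom_apply a g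

theorem PowerSeries.transcendental_div_X_pow {K : Type*} [Field K] {c : K} (hc : c ≠ 0) {n : ℕ}
    (hn : n ≠ 0) :
    Transcendental K (algebraMap K (FractionRing K⟦X⟧) c /
      algebraMap K⟦X⟧ (FractionRing K⟦X⟧) PowerSeries.X ^ n) := by
  intro halg
  have hint : IsIntegral K⟦X⟧ (algebraMap K (FractionRing K⟦X⟧) c /
      algebraMap K⟦X⟧ (FractionRing K⟦X⟧) PowerSeries.X ^ n) := halg.isIntegral.tower_top
  obtain ⟨y, hy⟩ := IsIntegrallyClosed.isIntegral_iff.1 hint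
  have hs0 : algebraMap K⟦X⟧ (FractionRing K⟦X⟧) PowerSeries.X ≠ 0 := by
    rw [Ne, FaithfulSMul.algebraMap_eq_zero_iff]
    exact PowerSeries.X_ne_zero
  rw [eq_div_iff (pow_ne_zero _ hs0), IsScalarTower.algebraMap_apply K K⟦X⟧ (FractionRing K⟦X⟧),
    ← map_pow, ← map_mul] at hy
  have := congrArg PowerSeries.constantCoeff (FaithfulSMul.algebraMap_injective _ _ hy)
  rw [map_mul, map_pow, PowerSeries.constantCoeff_X, zero_pow hn, mul_zero] at this
  exact hc this.symm

/-- Over some extension of `ℂ(t)`, an automorphism moves a root of `f(X) - t` through `deg f`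
distinct conjugates. -/
theorem exists_automorphism_pow_root_ne {f : ℂ[X]} (hf : 0 < f.natDegree) :
    ∃ (E : Type) (_ : Field E) (_ : Algebra (RatFunc ℂ) E) (σ : E ≃ₐ[RatFunc ℂ] E) (x : E),
      aeval x (monPoly f) = 0 ∧ ∀ k, 0 < k → k < f.natDegree → (σ ^ k) x ≠ x := by
  obtain ⟨Y, hY1, hY⟩ := exists_powerSeries_root hf
  have hlc : f.leadingCoeff ≠ 0 := leadingCoeff_ne_zero.2 (by rintro rfl; simp at hf)
  set s := algebraMap ℂ⟦X⟧ (FractionRing ℂ⟦X⟧) PowerSeries.X with hs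
  have hs0 : s ≠ 0 := by
    rw [hs, Ne, FaithfulSMul.algebraMap_eq_zero_iff]
    exact PowerSeries.X_ne_zero
  set τ := algebraMap ℂ (FractionRing ℂ⟦X⟧) f.leadingCoeff / s ^ f.natDegree with hτ
  have hτt : Transcendental ℂ τ := PowerSeries.transcendental_div_X_pow hlc hf.ne'
  obtain ⟨ζ, hζ⟩ : ∃ ζ : ℂ, IsPrimitiveRoot ζ f.natDegree :=
    ⟨_, Complex.isPrimitiveRoot_exp _ hf.ne'⟩
  have hζ0 : ζ ≠ 0 := hζ.ne_zero hf.ne'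
  let σ₀ : FractionRing ℂ⟦X⟧ ≃ₐ[ℂ] FractionRing ℂ⟦X⟧ :=
    IsFractionRing.algEquivOfAlgEquiv (PowerSeries.rescaleAlgEquiv ζ hζ0)
  have hσ₀ : ∀ a, σ₀ (algebraMap ℂ⟦X⟧ (FractionRing ℂ⟦X⟧) a) =
      algebraMap ℂ⟦X⟧ (FractionRing ℂ⟦X⟧) (PowerSeries.rescale ζ a) := fun a => by
    rw [← PowerSeries.rescaleAlgEquiv_apply ζ hζ0]
    exact IsFractionRing.algEquivOfAlgEquiv_algebraMap _ _
  have hσs : σ₀ s = algebraMap ℂ (FractionRing ℂ⟦X⟧) ζ * s := by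
    rw [hs, hσ₀, PowerSeries.rescale_X, map_mul,
      IsScalarTower.algebraMap_apply ℂ ℂ⟦X⟧ (FractionRing ℂ⟦X⟧)]
    rfl
  have hστ : σ₀ τ = τ := by
    rw [hτ, map_div₀, map_pow, hσs, AlgEquiv.commutes, mul_pow, ← map_pow, hζ.pow_eq_one, map_one,
      one_mul]
  let j : RatFunc ℂ →ₐ[ℂ] FractionRing ℂ⟦X⟧ :=
    (IntermediateField.val _).comp (RatFunc.algEquivOfTranscendental τ hτt).toAlgHom
  have hj : ∀ a, j a = aeval τ a.num / aeval τ a.denom := fun a =>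
    RatFunc.algEquivOfTranscendental_apply τ hτt a
  have hjX : j RatFunc.X = τ := RatFunc.algEquivOfTranscendental_X τ hτt
  let : Algebra (RatFunc ℂ) (FractionRing ℂ⟦X⟧) := j.toRingHom.toAlgebra
  have : IsScalarTower ℂ (RatFunc ℂ) (FractionRing ℂ⟦X⟧) :=
    IsScalarTower.of_algebraMap_eq fun c => (j.commutes c).symm
  let σ : FractionRing ℂ⟦X⟧ ≃ₐ[RatFunc ℂ] FractionRing ℂ⟦X⟧ :=
    AlgEquiv.ofRingEquiv (f := σ₀.toRingEquiv) fun a => by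
      change σ₀ (j a) = j a
      rw [hj, map_div₀, ← aeval_algHom_apply, ← aeval_algHom_apply, hστ]
  refine ⟨FractionRing ℂ⟦X⟧, inferInstance, inferInstance, σ,
    algebraMap ℂ⟦X⟧ (FractionRing ℂ⟦X⟧) Y / s, ?_, ?_⟩
  · rw [aeval_monPoly, hY, sub_eq_zero]
    exact hjX.symm
  intro k hk hkN heq
  have hiter : ∀ k : ℕ, ∃ Z : ℂ⟦X⟧, PowerSeries.constantCoeff Z = 1 ∧
      (σ ^ k) (algebraMap ℂ⟦X⟧ (FractionRing ℂ⟦X⟧) Y / s) =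
        algebraMap ℂ⟦X⟧ (FractionRing ℂ⟦X⟧) Z / (algebraMap ℂ (FractionRing ℂ⟦X⟧) (ζ ^ k) * s) := by
    intro k
    induction k with
    | zero => exact ⟨Y, hY1, by simp⟩
    | succ k ih =>
      obtain ⟨Z, hZ1, hZ⟩ := ih
      refine ⟨PowerSeries.rescale ζ Z, ?_, ?_⟩
      · rw [← PowerSeries.coeff_zero_eq_constantCoeff_apply, PowerSeries.coeff_rescale, pow_zero,
          one_mul, PowerSeries.coeff_zero_eq_constantCoeff_apply, hZ1]
      · rw [pow_succ', AlgEquiv.mul_apply, hZ]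
        change σ₀ _ = _
        rw [map_div₀, hσ₀, map_mul, AlgEquiv.commutes, hσs, ← mul_assoc, ← map_mul, ← pow_succ]
  obtain ⟨Z, hZ1, hZ⟩ := hiter k
  have hζk : algebraMap ℂ (FractionRing ℂ⟦X⟧) (ζ ^ k) ≠ 0 :=
    (_root_.map_ne_zero _).2 (pow_ne_zero _ hζ0)
  rw [hZ, ← div_div, div_left_inj' hs0, div_eq_iff hζk,
    IsScalarTower.algebraMap_apply ℂ ℂ⟦X⟧ (FractionRing ℂ⟦X⟧), ← map_mul] at heq
  have hcc := congrArg PowerSeries.constantCoeff (FaithfulSMul.algebraMap_injective _ _ heq)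
  rw [map_mul, hZ1, hY1, one_mul] at hcc
  exact hζ.pow_ne_one_of_pos_of_lt hk.ne' hkN hcc.symm

end Puiseux

section Cycle

variable {F E : Type*} [Field F] [Field E] [Algebra F E]

/-- If the first `deg p` iterates of an automorphism on a root of `p` are distinct, then they
exhaust the roots of `p`, and `p` splits. -/
theorem Polynomial.splits_and_exists_pow_of_forall_pow_ne {p : F[X]} (hp : p ≠ 0)
    (σ : E ≃ₐ[F] E) {x : E} (hx : aeval x p = 0)
    (hσ : ∀ k, 0 < k → k < p.natDegree → (σ ^ k) x ≠ x) :
    (p.map (algebraMap F E)).Splits ∧ ∀ y : E, aeval y p = 0 → ∃ k : ℕ, (σ ^ k) x = y := by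
  classical
  have hp' : p.map (algebraMap F E) ≠ 0 := map_ne_zero hp
  have hroot : ∀ k : ℕ, aeval ((σ ^ k) x) p = 0 := fun k => by
    rw [aeval_algHom_apply, hx, map_zero]
  have hlt : ∀ i j : ℕ, i < j → j < p.natDegree → (σ ^ i) x ≠ (σ ^ j) x := by
    intro i j hij hj h
    refine hσ (j - i) (Nat.sub_pos_of_lt hij) ((Nat.sub_le j i).trans_lt hj) ?_
    have h2 : (σ ^ j) x = (σ ^ i) ((σ ^ (j - i)) x) := by
      rw [← AlgEquiv.mul_apply, ← pow_add, Nat.add_sub_cancel' hij.le]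
    rw [h2] at h
    exact ((σ ^ i).injective h).symm
  have hinj : Set.InjOn (fun k : ℕ => (σ ^ k) x) (Finset.range p.natDegree) := by
    intro i hi j hj h
    rw [Finset.mem_coe, Finset.mem_range] at hi hj
    rcases lt_trichotomy i j with hij | hij | hij
    · exact absurd h (hlt i j hij hj)
    · exact hij
    · exact absurd h.symm (hlt j i hij hi)
  let S := (Finset.range p.natDegree).image fun k : ℕ => (σ ^ k) x
  have hScard : S.card = p.natDegree := by
    rw [Finset.card_image_of_injOn hinj, Finset.card_range]
  have hSsub : S ⊆ (p.map (algebraMap F E)).roots.toFinset := by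
    intro y hy
    obtain ⟨k, -, rfl⟩ := Finset.mem_image.1 hy
    rw [Multiset.mem_toFinset, mem_roots hp', IsRoot, eval_map_algebraMap]
    exact hroot k
  have hle : (p.map (algebraMap F E)).roots.card ≤ p.natDegree := by
    simpa using card_roots' (p.map (algebraMap F E))
  have hle' := Multiset.toFinset_card_le (p.map (algebraMap F E)).roots
  have hSeq : S = (p.map (algebraMap F E)).roots.toFinset :=
    Finset.eq_of_subset_of_card_le hSsub ((hle'.trans hle).trans hScard.ge)
  refine ⟨splits_iff_card_roots.2 (le_antisymm (card_roots' _) ?_), fun y hy => ?_⟩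
  · rw [natDegree_map, ← hScard, hSeq]
    exact hle'
  · have : y ∈ S := by
      rw [hSeq, Multiset.mem_toFinset, mem_roots hp', IsRoot, eval_map_algebraMap]
      exact hy
    obtain ⟨k, -, hk⟩ := Finset.mem_image.1 this
    exact ⟨k, hk⟩

/-- A cyclic automorphism over an arbitrary extension descends to the splitting field. -/
theorem Polynomial.exists_automorphism_splittingField_zpow {p : F[X]} (hp : p ≠ 0)
    (σ : E ≃ₐ[F] E) {x : E} (hx : aeval x p = 0)
    (hσ : ∀ k, 0 < k → k < p.natDegree → (σ ^ k) x ≠ x) :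
    ∃ τ : p.SplittingField ≃ₐ[F] p.SplittingField, ∀ y z : p.SplittingField,
      aeval y p = 0 → aeval z p = 0 → ∃ k : ℤ, (τ ^ k) y = z := by
  obtain ⟨hsplit, hpow⟩ := splits_and_exists_pow_of_forall_pow_ne hp σ hx hσ
  let φ : p.SplittingField →ₐ[F] E := SplittingField.lift p hsplit
  let : Algebra p.SplittingField E := φ.toRingHom.toAlgebra
  have : IsScalarTower F p.SplittingField E :=
    IsScalarTower.of_algebraMap_eq fun a => (φ.commutes a).symm
  have : Normal F p.SplittingField := Normal.of_isSplittingField p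
  refine ⟨σ.restrictNormal p.SplittingField, fun y z hy hz => ?_⟩
  have hcomm : ∀ (k : ℕ) y, φ (((σ.restrictNormal p.SplittingField) ^ k) y) = (σ ^ k) (φ y) := by
    intro k
    induction k with
    | zero => intro y; rfl
    | succ k ih =>
      intro y
      rw [pow_succ', AlgEquiv.mul_apply, pow_succ', AlgEquiv.mul_apply, ← ih]
      exact σ.restrictNormal_commutes p.SplittingField _
  obtain ⟨i, hi⟩ := hpow (φ y) (by rw [aeval_algHom_apply, hy, map_zero])
  obtain ⟨j, hj⟩ := hpow (φ z) (by rw [aeval_algHom_apply, hz, map_zero])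
  refine ⟨(j : ℤ) - i, ?_⟩
  set τ := σ.restrictNormal p.SplittingField
  have h : (τ ^ j) y = (τ ^ i) z := by
    refine φ.injective ?_
    change φ _ = φ _
    rw [hcomm, hcomm, ← hi, ← hj, ← AlgEquiv.mul_apply, ← AlgEquiv.mul_apply, ← pow_add,
      ← pow_add, add_comm]
  rw [sub_eq_neg_add, zpow_add, zpow_neg, zpow_natCast, zpow_natCast, AlgEquiv.mul_apply, h,
    ← AlgEquiv.mul_apply, inv_mul_cancel, AlgEquiv.one_apply]

end Cycle

section GaloisAction

/-- If `B` acts on `E` through exactly the automorphisms of `E/F`, then the permutation group of an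
irreducible polynomial is the action of `B` on the cosets of the stabilizer of a root. -/
theorem Polynomial.Gal.sameImage_quotient {F E B : Type*} [Field F] [Field E] [Algebra F E]
    [Normal F E] [Group B] [MulAction B E] {p : F[X]} (hp : Irreducible p)
    (h₁ : ∀ b : B, ∃ φ : E ≃ₐ[F] E, ∀ z : E, b • z = φ z)
    (h₂ : ∀ φ : E ≃ₐ[F] E, ∃ b : B, ∀ z : E, b • z = φ z)
    {y : E} (hy : aeval y p = 0) (S : Subgroup B) (hS : ∀ b, b ∈ S ↔ b • y = y) :
    SameImage B (B ⧸ S) p.Gal (p.rootSet p.SplittingField) := by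
  have hsplit : Fact (p.map (algebraMap F E)).Splits := ⟨by
    have h := Normal.splits (F := F) inferInstance y
    rw [← minpoly.eq_of_irreducible hp hy, Polynomial.map_mul] at h
    exact h.of_dvd (mul_ne_zero (map_ne_zero hp.ne_zero) (map_ne_zero
      (C_ne_zero.2 (inv_ne_zero (leadingCoeff_ne_zero.2 hp.ne_zero))))) (dvd_mul_right _ _)⟩
  have hmem : ∀ (b : B) (x : p.rootSet E), b • (x : E) ∈ p.rootSet E := fun b x => by
    obtain ⟨φ, hφ⟩ := h₁ b
    rw [hφ]
    exact (mem_rootSet.2 ⟨hp.ne_zero, by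
      rw [aeval_algHom_apply, (mem_rootSet.1 x.2).2, map_zero]⟩)
  let : MulAction B (p.rootSet E) :=
    { smul := fun b x => ⟨b • (x : E), hmem b x⟩
      one_smul := fun x => Subtype.ext (one_smul B (x : E))
      mul_smul := fun a b x => Subtype.ext (mul_smul a b (x : E)) }
  have hsmul : ∀ (b : B) (x : p.rootSet E), ((b • x : p.rootSet E) : E) = b • (x : E) :=
    fun _ _ => rfl
  let y' : p.rootSet E := ⟨y, mem_rootSet.2 ⟨hp.ne_zero, hy⟩⟩
  have hrestr : ∀ (b : B) (φ : E ≃ₐ[F] E), (∀ z, b • z = φ z) → ∀ x : p.rootSet E,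
      (Polynomial.Gal.rootsEquivRoots p E).symm (b • x) =
        Polynomial.Gal.restrict p E φ • (Polynomial.Gal.rootsEquivRoots p E).symm x := by
    intro b φ hφ x
    rw [Equiv.symm_apply_eq, ← Polynomial.Gal.smul_def]
    apply Subtype.ext
    rw [Polynomial.Gal.restrict_smul, hsmul, hφ]
  refine (SameImage.quotient_of_transitive y' S (fun b => ?_) fun z => ?_).trans
    ⟨(Polynomial.Gal.rootsEquivRoots p E).symm, fun b => ?_, fun g => ?_⟩
  · rw [hS, Subtype.ext_iff]
    rfl
  · have := Polynomial.Gal.galAction_isPretransitive p E hp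
    obtain ⟨g, hg⟩ := MulAction.exists_smul_eq p.Gal y' z
    obtain ⟨φ, rfl⟩ := Polynomial.Gal.restrict_surjective p E g
    obtain ⟨b, hb⟩ := h₂ φ
    refine ⟨b, Subtype.ext ?_⟩
    rw [← hg, Polynomial.Gal.restrict_smul, hsmul, hb]
  · obtain ⟨φ, hφ⟩ := h₁ b
    exact ⟨_, hrestr b φ hφ⟩
  · obtain ⟨φ, rfl⟩ := Polynomial.Gal.restrict_surjective p E g
    obtain ⟨b, hb⟩ := h₂ φ
    exact ⟨b, hrestr b φ hb⟩

instance Polynomial.Gal.faithfulSMul_rootSet {F : Type*} [Field F] (p : F[X]) :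
    FaithfulSMul p.Gal (p.rootSet p.SplittingField) :=
  ⟨fun h => Polynomial.Gal.ext p fun x hx => congrArg Subtype.val (h ⟨x, hx⟩)⟩

theorem monPermIso_of_sameImage {u v : ℂ[X]}
    (h : SameImage (monPoly u).Gal ((monPoly u).rootSet (monPoly u).SplittingField)
      (monPoly v).Gal ((monPoly v).rootSet (monPoly v).SplittingField)) : MonPermIso u v :=
  h.exists_mulEquiv

end GaloisAction

section Fields

open IntermediateField

/-- Evaluation of rational functions at a transcendental element. -/
theorem RatFunc.exists_algHom_of_transcendental {K L : Type*} [Field K] [Field L] [Algebra K L]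
    {y : L} (hy : Transcendental K y) :
    ∃ j : RatFunc K →ₐ[K] L, (∀ p : K[X], j (algebraMap K[X] (RatFunc K) p) = aeval y p) ∧
      ∀ z, z ∈ K⟮y⟯ ↔ ∃ a, j a = z := by
  refine ⟨(IntermediateField.val _).comp (RatFunc.algEquivOfTranscendental y hy).toAlgHom,
    fun p => ?_, fun z => ⟨fun hz => ?_, ?_⟩⟩
  · change ((RatFunc.algEquivOfTranscendental y hy (algebraMap _ _ p) : K⟮y⟯) : L) = _
    rw [RatFunc.algEquivOfTranscendental_algebraMap]
    simp
  · obtain ⟨a, ha⟩ := (RatFunc.algEquivOfTranscendental y hy).surjective ⟨z, hz⟩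
    exact ⟨a, congrArg Subtype.val ha⟩
  · rintro ⟨a, rfl⟩
    exact (RatFunc.algEquivOfTranscendental y hy a).2

theorem RatFunc.aeval_X_eq_algebraMap {K : Type*} [Field K] (p : K[X]) :
    aeval (RatFunc.X : RatFunc K) p = algebraMap K[X] (RatFunc K) p := by
  rw [← RatFunc.algebraMap_X, aeval_algebraMap_apply, aeval_X_left_apply]

theorem Indecomposable.eq_top_or_eq_adjoin {u : ℂ[X]} (hu : Indecomposable u)
    (E : IntermediateField ℂ (RatFunc ℂ)) (huE : algebraMap ℂ[X] (RatFunc ℂ) u ∈ E) :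
    RatFunc.X ∈ E ∨ E = ℂ⟮algebraMap ℂ[X] (RatFunc ℂ) u⟯ := by
  obtain ⟨hdeg, hu⟩ := hu
  have hpos : 0 < u.natDegree := zero_lt_one.trans hdeg
  obtain ⟨h, rfl⟩ := RatFunc.exists_eq_adjoin_polynomial E hpos huE
  have hh : h.natDegree ≠ 0 := by
    intro h0
    rw [eq_C_of_natDegree_eq_zero h0, RatFunc.algebraMap_C, ← RatFunc.algebraMap_eq_C,
      adjoin_simple_eq_bot_iff.2 (IntermediateField.algebraMap_mem _ _), mem_bot] at huE
    obtain ⟨c, hc⟩ := huE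
    rw [RatFunc.algebraMap_eq_C, ← RatFunc.algebraMap_C] at hc
    rw [← RatFunc.algebraMap_injective ℂ hc, natDegree_C] at hpos
    exact hpos.false
  obtain ⟨g, hg⟩ := RatFunc.exists_eq_comp_of_mem_adjoin hh huE
  have hmul : u.natDegree = g.natDegree * h.natDegree := by rw [hg, natDegree_comp]
  have hor : u.natDegree ≤ g.natDegree ∨ u.natDegree ≤ h.natDegree := by
    by_contra! hlt
    exact hu ⟨g, h, hlt.1, hlt.2, hg⟩
  rcases hor with hle | hle
  · left
    have h1 : h.natDegree = 1 := by
      have hg0 : 0 < g.natDegree := hpos.trans_le hle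
      rw [hmul] at hle
      have := Nat.le_of_mul_le_mul_left (hle.trans_eq (mul_one _).symm) hg0
      omega
    rw [← RatFunc.aeval_X_eq_algebraMap, adjoin_aeval_eq_of_natDegree_eq_one h1]
    exact mem_adjoin_simple_self _ _
  · right
    have h1 : g.natDegree = 1 := by
      rw [hmul] at hle hpos
      have := Nat.le_of_mul_le_mul_right (hle.trans_eq (one_mul _).symm) (Nat.pos_of_ne_zero hh)
      have := Nat.pos_of_mul_pos_right hpos
      omega
    rw [hg, ← RatFunc.aeval_X_eq_algebraMap (g.comp h), aeval_comp,
      RatFunc.aeval_X_eq_algebraMap, adjoin_aeval_eq_of_natDegree_eq_one h1]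

variable {Ω : Type*} [Field Ω] [Algebra ℂ Ω]

theorem Indecomposable.mem_or_le_adjoin {u : ℂ[X]} (hu : Indecomposable u) {y : Ω}
    (hy : Transcendental ℂ y) (F : IntermediateField ℂ Ω) (hF : F ≤ ℂ⟮y⟯) (hw : aeval y u ∈ F) :
    y ∈ F ∨ F ≤ ℂ⟮aeval y u⟯ := by
  obtain ⟨j, hj, hrange⟩ := RatFunc.exists_algHom_of_transcendental hy
  have hjX : j RatFunc.X = y := by rw [← RatFunc.algebraMap_X, hj, aeval_X]
  rcases hu.eq_top_or_eq_adjoin (F.comap j) (by rwa [← hj] at hw) with hX | hE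
  · left
    rw [← hjX]
    exact hX
  · right
    intro z hz
    obtain ⟨a, rfl⟩ := (hrange z).1 (hF hz)
    have ha : a ∈ F.comap j := hz
    rw [hE] at ha
    have := (IntermediateField.mem_map (f := j) _).2 ⟨a, ha, rfl⟩
    rwa [adjoin_map, Set.image_singleton, hj] at this

theorem Polynomial.notMem_adjoin_aeval {K L : Type*} [Field K] [Field L] [Algebra K L] {u : K[X]}
    (hu : 1 < u.natDegree) {y : L} (hy : Transcendental K y) : y ∉ K⟮aeval y u⟯ := by
  intro hmem
  obtain ⟨j, hj, -⟩ := RatFunc.exists_algHom_of_transcendental hy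
  rw [← hj, ← Set.image_singleton, ← adjoin_map, mem_map] at hmem
  obtain ⟨a, ha, hay⟩ := hmem
  have haX : a = algebraMap K[X] (RatFunc K) X :=
    j.injective (show j a = j _ by rw [hay, hj, aeval_X])
  rw [haX] at ha
  obtain ⟨g, hg⟩ := RatFunc.exists_eq_comp_of_mem_adjoin (zero_lt_one.trans hu).ne' ha
  have := congrArg natDegree hg
  rw [natDegree_X, natDegree_comp] at this
  have := Nat.eq_one_of_mul_eq_one_left this.symm
  omega

variable {K : Type*} [Field K] [Algebra ℂ K] [Algebra K Ω] [IsScalarTower ℂ K Ω]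

theorem IntermediateField.algebraMap_mem_of_adjoin_eq_top {t : K} (ht : ℂ⟮t⟯ = ⊤)
    {F : IntermediateField ℂ Ω} (htF : algebraMap K Ω t ∈ F) (a : K) : algebraMap K Ω a ∈ F := by
  have : ℂ⟮t⟯ ≤ F.comap (IsScalarTower.toAlgHom ℂ K Ω) := adjoin_simple_le_iff.2 htF
  rw [ht] at this
  exact this mem_top

theorem IntermediateField.mem_adjoin_simple_iff_of_aeval_eq {t : K} (ht : ℂ⟮t⟯ = ⊤) {y : Ω}
    {q : ℂ[X]} (hq : aeval y q = algebraMap K Ω t) (z : Ω) : z ∈ K⟮y⟯ ↔ z ∈ ℂ⟮y⟯ := by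
  have hle : ℂ⟮y⟯ ≤ K⟮y⟯.restrictScalars ℂ :=
    adjoin_simple_le_iff.2 (mem_adjoin_simple_self K y)
  refine ⟨fun hz => ?_, fun hz => hle hz⟩
  have htF : algebraMap K Ω t ∈ ℂ⟮y⟯ := by
    rw [← hq]
    exact algebra_adjoin_le_adjoin ℂ _ (aeval_mem_adjoin_singleton ℂ y)
  refine adjoin_induction K (p := fun z _ => z ∈ ℂ⟮y⟯) ?_ ?_ ?_ ?_ ?_ hz
  · rintro z rfl
    exact mem_adjoin_simple_self ℂ z
  · exact fun a => algebraMap_mem_of_adjoin_eq_top ht htF a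
  · exact fun _ _ _ _ => add_mem
  · exact fun _ _ => inv_mem
  · exact fun _ _ _ _ => mul_mem

end Fields

section Stabilizers

open IntermediateField

variable {K Ω : Type*} [Field K] [Field Ω] [Algebra K Ω]

theorem IntermediateField.stabilizer_eq_fixingSubgroup (y : Ω) :
    MulAction.stabilizer (Ω ≃ₐ[K] Ω) y = K⟮y⟯.fixingSubgroup := by
  ext σ
  rw [MulAction.mem_stabilizer_iff, IntermediateField.mem_fixingSubgroup_iff]
  refine ⟨fun h z hz => ?_, fun h => h y (mem_adjoin_simple_self K y)⟩
  refine adjoin_induction K (p := fun z _ => σ z = z) ?_ ?_ ?_ ?_ ?_ hz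
  · rintro z rfl
    exact h
  · exact fun a => σ.commutes a
  · exact fun a b _ _ ha hb => by rw [map_add, ha, hb]
  · exact fun a _ ha => by rw [map_inv₀, ha]
  · exact fun a b _ _ ha hb => by rw [map_mul, ha, hb]

theorem IntermediateField.mem_adjoin_simple_of_forall_stabilizer [IsGalois K Ω]
    [FiniteDimensional K Ω] {y z : Ω}
    (h : ∀ σ : Ω ≃ₐ[K] Ω, σ y = y → σ z = z) : z ∈ K⟮y⟯ := by
  rw [← IsGalois.fixedField_fixingSubgroup K⟮y⟯, ← stabilizer_eq_fixingSubgroup]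
  rintro ⟨σ, hσ⟩
  exact h σ hσ

variable [Algebra ℂ K] [Algebra ℂ Ω] [IsScalarTower ℂ K Ω]

theorem smul_aeval (σ : Ω ≃ₐ[K] Ω) (y : Ω) (u : ℂ[X]) : σ (aeval y u) = aeval (σ y) u :=
  (aeval_algHom_apply (σ.restrictScalars ℂ) y u).symm

/-- An indecomposable polynomial corresponds to a covering of point stabilizers. -/
theorem Indecomposable.stabilizer_covBy [IsGalois K Ω] [FiniteDimensional K Ω] {t : K}
    (ht : ℂ⟮t⟯ = ⊤) {u q : ℂ[X]} (hu : Indecomposable u) {y : Ω} (hy : Transcendental ℂ y)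
    (hq : aeval (aeval y u) q = algebraMap K Ω t) :
    MulAction.stabilizer (Ω ≃ₐ[K] Ω) y ⋖ MulAction.stabilizer (Ω ≃ₐ[K] Ω) (aeval y u) := by
  have hle : MulAction.stabilizer (Ω ≃ₐ[K] Ω) y ≤ MulAction.stabilizer (Ω ≃ₐ[K] Ω) (aeval y u) := by
    intro σ hσ
    rw [MulAction.mem_stabilizer_iff] at hσ ⊢
    exact (smul_aeval σ y u).trans (congrArg (fun z => aeval z u) hσ)
  have hq' : aeval y (q.comp u) = algebraMap K Ω t := by rw [aeval_comp, hq]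
  refine ⟨lt_of_le_not_ge hle fun hge => ?_, fun M hM₁ hM₂ => ?_⟩
  · refine notMem_adjoin_aeval hu.1 hy
      ((mem_adjoin_simple_iff_of_aeval_eq ht hq y).1 ?_)
    exact mem_adjoin_simple_of_forall_stabilizer fun σ hσ => hge hσ
  · have hF : (fixedField M).restrictScalars ℂ ≤ ℂ⟮y⟯ := by
      intro z hz
      rw [← mem_adjoin_simple_iff_of_aeval_eq ht hq']
      exact mem_adjoin_simple_of_forall_stabilizer fun σ hσ => hz ⟨σ, hM₁.le hσ⟩
    have hw : aeval y u ∈ (fixedField M).restrictScalars ℂ := by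
      rintro ⟨σ, hσ⟩
      exact hM₂.le hσ
    rcases hu.mem_or_le_adjoin hy _ hF hw with hmem | hle'
    · exact hM₁.not_ge fun σ hσ => hmem ⟨σ, hσ⟩
    · refine hM₂.not_ge fun σ hσ => ?_
      rw [← fixingSubgroup_fixedField M, IntermediateField.mem_fixingSubgroup_iff]
      intro z hz
      have hz' : z ∈ K⟮aeval y u⟯ := (mem_adjoin_simple_iff_of_aeval_eq ht hq z).2 (hle' hz)
      rw [stabilizer_eq_fixingSubgroup, IntermediateField.mem_fixingSubgroup_iff] at hσ
      exact hσ z hz'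

/-- `Mon(u)` is the action of the stabilizer of `u(y)` on the cosets of the stabilizer of `y`. -/
theorem sameImage_stabilizer_monPoly [IsGalois K Ω] {t : K}
    (ht : ℂ⟮t⟯ = ⊤) {u q : ℂ[X]} (hu : 0 < u.natDegree) {y : Ω} (hw : Transcendental ℂ (aeval y u))
    (hq : aeval (aeval y u) q = algebraMap K Ω t) :
    SameImage (MulAction.stabilizer (Ω ≃ₐ[K] Ω) (aeval y u))
      (MulAction.stabilizer (Ω ≃ₐ[K] Ω) (aeval y u) ⧸
        (MulAction.stabilizer (Ω ≃ₐ[K] Ω) y).subgroupOf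
          (MulAction.stabilizer (Ω ≃ₐ[K] Ω) (aeval y u)))
      (monPoly u).Gal ((monPoly u).rootSet (monPoly u).SplittingField) := by
  obtain ⟨j, hj, hrange⟩ := RatFunc.exists_algHom_of_transcendental hw
  have hjX : j RatFunc.X = aeval y u := by rw [← RatFunc.algebraMap_X, hj, aeval_X]
  let : Algebra (RatFunc ℂ) Ω := j.toRingHom.toAlgebra
  have : IsScalarTower ℂ (RatFunc ℂ) Ω :=
    IsScalarTower.of_algebraMap_eq fun c => (j.commutes c).symm
  have hrangeK : ∀ z, z ∈ K⟮aeval y u⟯ ↔ ∃ a, j a = z := fun z => by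
    rw [mem_adjoin_simple_iff_of_aeval_eq ht hq, hrange]
  let e₀ : RatFunc ℂ →+* K⟮aeval y u⟯ :=
    j.toRingHom.codRestrict K⟮aeval y u⟯ fun a => (hrangeK _).2 ⟨a, rfl⟩
  let e : RatFunc ℂ ≃+* K⟮aeval y u⟯ := RingEquiv.ofBijective e₀
    ⟨e₀.injective, fun z => by
      obtain ⟨a, ha⟩ := (hrangeK z).1 z.2
      exact ⟨a, Subtype.ext ha⟩⟩
  have : Normal (RatFunc ℂ) Ω := by
    refine Normal.of_equiv_equiv (F := K⟮aeval y u⟯) (E := Ω) (f := e.symm)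
      (g := RingEquiv.refl Ω) (RingHom.ext fun z => ?_)
    exact congrArg Subtype.val (e.apply_symm_apply z)
  refine Polynomial.Gal.sameImage_quotient (irreducible_monPoly hu) ?_ ?_ (y := y) ?_ _ ?_
  · rintro ⟨σ, hσ⟩
    rw [stabilizer_eq_fixingSubgroup, IntermediateField.mem_fixingSubgroup_iff] at hσ
    exact ⟨AlgEquiv.ofRingEquiv (f := σ.toRingEquiv) fun a => hσ _ ((hrangeK _).2 ⟨a, rfl⟩),
      fun _ => rfl⟩
  · intro φ
    have hφ : ∀ z ∈ K⟮aeval y u⟯, φ z = z := fun z hz => by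
      obtain ⟨a, rfl⟩ := (hrangeK z).1 hz
      exact φ.commutes a
    exact ⟨⟨AlgEquiv.ofRingEquiv (f := φ.toRingEquiv) fun a =>
      hφ _ (IntermediateField.algebraMap_mem _ a),
      hφ _ (mem_adjoin_simple_self _ _)⟩, fun _ => rfl⟩
  · rw [aeval_monPoly, sub_eq_zero]
    exact hjX.symm
  · exact fun b => Iff.rfl

end Stabilizers

section JordanHolder

namespace Subgroup

variable {G : Type*} [Group G]

/-- The actions of `B` on the cosets of `A` and of `B'` on the cosets of `A'` have isomorphic images
as permutation groups. -/
def SameCosetImage (A B A' B' : Subgroup G) : Prop :=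
  SameImage B (B ⧸ A.subgroupOf B) B' (B' ⧸ A'.subgroupOf B')

/-- A version of the Jordan–Hölder theorem for maximal chains of subgroups containing `H`, when `H`
has a commuting set of coset representatives. -/
theorem exists_equiv_sameCosetImage {H : Subgroup G} {I : Set G}
    (hI : ∀ i ∈ I, ∀ j ∈ I, Commute i j) (hG : ∀ g, ∃ h ∈ H, ∃ i ∈ I, g = h * i)
    (hG' : ∀ g, ∃ i ∈ I, ∃ h ∈ H, g = i * h) {m n : ℕ} {a b : ℕ → Subgroup G}
    (ha : ∀ i, H ≤ a i) (hb : ∀ i, H ≤ b i) (ha₀ : a 0 = ⊤) (hb₀ : b 0 = ⊤)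
    (ham : a m = H) (hbn : b n = H) (hacov : ∀ i < m, a (i + 1) ⋖ a i)
    (hbcov : ∀ i < n, b (i + 1) ⋖ b i) :
    m = n ∧ ∃ χ : Fin m ≃ Fin n, ∀ i : Fin m,
      SameCosetImage (a (i + 1)) (a i) (b (χ i + 1)) (b (χ i)) := by
  have := isModularLattice_Ici_of_factorization hI hG hG'
  let series : ∀ (k : ℕ) (c : ℕ → Subgroup G), (∀ i, H ≤ c i) → (∀ i < k, c (i + 1) ⋖ c i) →
      CompositionSeries (Set.Ici H) := fun k c hc hcov =>
    { length := k
      toFun := fun i => ⟨c (k - i), hc _⟩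
      step := fun i => by
        have h := hcov (k - (i + 1)) (by omega)
        rw [show k - (i + 1) + 1 = k - i by omega] at h
        exact ⟨h.1, fun d hd₁ hd₂ => h.2 hd₁ hd₂⟩ }
  have hmeet : (series m a ha hacov).head = (series n b hb hbcov).head :=
    Subtype.ext (ham.trans hbn.symm)
  have hjoin : (series m a ha hacov).last = (series n b hb hbcov).last := by
    refine Subtype.ext ?_
    change a (m - m) = b (n - n)
    rw [Nat.sub_self, Nat.sub_self, ha₀, hb₀]
  obtain ⟨e, he⟩ := CompositionSeries.jordan_holder _ _ hmeet hjoin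
  let e' : Fin m ≃ Fin n := e
  let χ : Fin m ≃ Fin n := Fin.revPerm.trans (e'.trans Fin.revPerm)
  refine ⟨by simpa using Fintype.card_congr χ, χ, fun i => ?_⟩
  have key := JordanHolderLattice.Iso.rel
    (fun x y : Set.Ici H × Set.Ici H => SameCosetImage x.1.1 x.2.1 y.1.1 y.2.1)
    SameImage.refl SameImage.symm SameImage.trans
    (fun {x y} _ => sameImage_sup_inf_of_factorization hI hG hG' x.2 y.2) (he i.rev)
  have h₁ : m - (i.rev.castSucc : ℕ) = i + 1 := by simp; omega
  have h₂ : m - (i.rev.succ : ℕ) = i := by simp; omega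
  have h₃ : n - ((e' i.rev).castSucc : ℕ) = χ i + 1 := by simp [χ]; omega
  have h₄ : n - ((e' i.rev).succ : ℕ) = χ i := by simp [χ]
  change SameCosetImage (a (m - (i.rev.castSucc : ℕ))) (a (m - (i.rev.succ : ℕ)))
    (b (n - ((e' i.rev).castSucc : ℕ))) (b (n - ((e' i.rev).succ : ℕ))) at key
  rwa [h₁, h₂, h₃, h₄] at key

end Subgroup

end JordanHolder

section Assembly

open IntermediateField

theorem compList_append (L M : List ℂ[X]) :
    compList (L ++ M) = (compList L).comp (compList M) := by
  induction L with
  | nil => exact (X_comp).symm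
  | cons u L ih =>
    change u.comp (compList (L ++ M)) = (u.comp (compList L)).comp (compList M)
    rw [ih, comp_assoc]

section Tail

variable {Ω : Type*} [Field Ω] [Algebra ℂ Ω]

/-- The value at `x` of the composition of all but the first `i` polynomials of the list. -/
noncomputable def tailValue (L : List ℂ[X]) (x : Ω) (i : ℕ) : Ω := aeval x (compList (L.drop i))

theorem tailValue_eq_aeval_succ (L : List ℂ[X]) (x : Ω) {i : ℕ} (hi : i < L.length) :
    tailValue L x i = aeval (tailValue L x (i + 1)) L[i] := by
  rw [tailValue, List.drop_eq_getElem_cons hi, tailValue, ← aeval_comp]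
  rfl

theorem tailValue_length (L : List ℂ[X]) (x : Ω) : tailValue L x L.length = x := by
  rw [tailValue, List.drop_length]
  exact aeval_X x

theorem aeval_tailValue (L : List ℂ[X]) (x : Ω) (i : ℕ) :
    aeval (tailValue L x i) (compList (L.take i)) = aeval x (compList L) := by
  rw [tailValue, ← aeval_comp, ← compList_append, List.take_append_drop]

theorem Polynomial.transcendental_of_transcendental_aeval {K A : Type*} [Field K] [Ring A]
    [Algebra K A] {x : A} {q : K[X]} (h : Transcendental K (aeval x q)) : Transcendental K x :=
  fun hx => h (IsIntegral.of_mem_of_fg _ hx.isIntegral.fg_adjoin_singleton _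
    (aeval_mem_adjoin_singleton K x)).isAlgebraic

variable {K : Type*} [Field K] [Algebra K Ω] {t : K} {L : List ℂ[X]} {x : Ω}

theorem stabilizer_tailValue_zero (hx : aeval x (compList L) = algebraMap K Ω t) :
    MulAction.stabilizer (Ω ≃ₐ[K] Ω) (tailValue L x 0) = ⊤ := by
  refine eq_top_iff.2 fun σ _ => ?_
  rw [tailValue, List.drop_zero, hx, MulAction.mem_stabilizer_iff]
  exact σ.commutes t

theorem transcendental_tailValue (htt : Transcendental ℂ (algebraMap K Ω t))
    (hx : aeval x (compList L) = algebraMap K Ω t) (i : ℕ) :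
    Transcendental ℂ (tailValue L x i) := by
  rw [← hx, ← aeval_tailValue L x i] at htt
  exact transcendental_of_transcendental_aeval htt

variable [Algebra ℂ K] [IsScalarTower ℂ K Ω]

theorem stabilizer_le_stabilizer_tailValue (L : List ℂ[X]) (x : Ω) (i : ℕ) :
    MulAction.stabilizer (Ω ≃ₐ[K] Ω) x ≤ MulAction.stabilizer (Ω ≃ₐ[K] Ω) (tailValue L x i) := by
  intro σ hσ
  rw [MulAction.mem_stabilizer_iff] at hσ ⊢
  exact (smul_aeval σ x _).trans (congrArg (fun z => aeval z _) hσ)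

theorem stabilizer_tailValue_covBy [IsGalois K Ω] [FiniteDimensional K Ω] (ht : ℂ⟮t⟯ = ⊤)
    (htt : Transcendental ℂ (algebraMap K Ω t)) (hx : aeval x (compList L) = algebraMap K Ω t)
    (hL : ∀ u ∈ L, Indecomposable u) {i : ℕ} (hi : i < L.length) :
    MulAction.stabilizer (Ω ≃ₐ[K] Ω) (tailValue L x (i + 1)) ⋖
      MulAction.stabilizer (Ω ≃ₐ[K] Ω) (tailValue L x i) := by
  have hq := aeval_tailValue L x i
  rw [hx, tailValue_eq_aeval_succ L x hi] at hq
  rw [tailValue_eq_aeval_succ L x hi]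
  exact (hL _ (List.getElem_mem hi)).stabilizer_covBy ht (transcendental_tailValue htt hx _) hq

theorem sameImage_stabilizer_tailValue [IsGalois K Ω] (ht : ℂ⟮t⟯ = ⊤)
    (htt : Transcendental ℂ (algebraMap K Ω t)) (hx : aeval x (compList L) = algebraMap K Ω t)
    (hL : ∀ u ∈ L, Indecomposable u) {i : ℕ} (hi : i < L.length) :
    SameImage (MulAction.stabilizer (Ω ≃ₐ[K] Ω) (tailValue L x i))
      (MulAction.stabilizer (Ω ≃ₐ[K] Ω) (tailValue L x i) ⧸
        (MulAction.stabilizer (Ω ≃ₐ[K] Ω) (tailValue L x (i + 1))).subgroupOf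
          (MulAction.stabilizer (Ω ≃ₐ[K] Ω) (tailValue L x i)))
      (monPoly L[i]).Gal ((monPoly L[i]).rootSet (monPoly L[i]).SplittingField) := by
  have hq := aeval_tailValue L x i
  have hw := transcendental_tailValue htt hx i
  rw [hx, tailValue_eq_aeval_succ L x hi] at hq
  rw [tailValue_eq_aeval_succ L x hi] at hw ⊢
  exact sameImage_stabilizer_monPoly ht (zero_lt_one.trans (hL _ (List.getElem_mem hi)).1) hw hq

end Tail

theorem RatFunc.adjoin_X_eq_top {K : Type*} [Field K] : K⟮(RatFunc.X : RatFunc K)⟯ = ⊤ := by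
  refine eq_top_iff.2 fun a _ => ?_
  rw [← RatFunc.num_div_denom a, ← RatFunc.aeval_X_eq_algebraMap, ← RatFunc.aeval_X_eq_algebraMap]
  exact div_mem (algebra_adjoin_le_adjoin K _ (aeval_mem_adjoin_singleton K _))
    (algebra_adjoin_le_adjoin K _ (aeval_mem_adjoin_singleton K _))

end Assembly

theorem monodromy_permutation_invariant
    (f : ℂ[X]) (hf : 1 < f.natDegree)
    (U V : List ℂ[X]) (hU : CompleteDecomp f U) (hV : CompleteDecomp f V) :
    U.length = V.length ∧
      ∃ χ : Fin U.length ≃ Fin V.length,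
        ∀ i : Fin U.length, MonPermIso (U.get i) (V.get (χ i)) := by
  have hpos : 0 < f.natDegree := zero_lt_one.trans hf
  have hirr : Irreducible (monPoly f) := irreducible_monPoly hpos
  have : IsGalois (RatFunc ℂ) (monPoly f).SplittingField :=
    IsGalois.of_separable_splitting_field hirr.separable
  obtain ⟨E, _, _, ρ, x₀, hx₀, hρ⟩ := exists_automorphism_pow_root_ne hpos
  rw [← natDegree_monPoly] at hρ
  obtain ⟨σ, hσ⟩ := exists_automorphism_splittingField_zpow hirr.ne_zero ρ hx₀ hρ
  obtain ⟨x, hx⟩ : ∃ x : (monPoly f).SplittingField, aeval x (monPoly f) = 0 := by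
    obtain ⟨x, hx⟩ := (SplittingField.splits (monPoly f)).exists_eval_eq_zero (by
      rw [degree_map]
      exact hirr.degree_pos.ne')
    exact ⟨x, by rwa [← eval_map_algebraMap]⟩
  have htt : Transcendental ℂ (algebraMap (RatFunc ℂ) (monPoly f).SplittingField RatFunc.X) :=
    (transcendental_algebraMap_iff (algebraMap (RatFunc ℂ) (monPoly f).SplittingField).injective).2
      RatFunc.transcendental_X
  have hfx : aeval x f = algebraMap (RatFunc ℂ) (monPoly f).SplittingField RatFunc.X := by
    rwa [aeval_monPoly, sub_eq_zero] at hx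
  have hUx := (congrArg (aeval x) hU.2.symm).trans hfx
  have hVx := (congrArg (aeval x) hV.2.symm).trans hfx
  have hG' : ∀ g : (monPoly f).SplittingField ≃ₐ[RatFunc ℂ] (monPoly f).SplittingField,
      ∃ i ∈ (Subgroup.zpowers σ : Set _), ∃ h ∈ MulAction.stabilizer _ x, g = i * h := by
    intro g
    obtain ⟨k, hk⟩ := hσ x (g x) hx (by rw [aeval_algHom_apply, hx, map_zero])
    refine ⟨σ ^ k, ⟨k, rfl⟩, (σ ^ k)⁻¹ * g, ?_, by rw [mul_inv_cancel_left]⟩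
    rw [MulAction.mem_stabilizer_iff, mul_smul, inv_smul_eq_iff]
    exact hk.symm
  have hG : ∀ g : (monPoly f).SplittingField ≃ₐ[RatFunc ℂ] (monPoly f).SplittingField,
      ∃ h ∈ MulAction.stabilizer _ x, ∃ i ∈ (Subgroup.zpowers σ : Set _), g = h * i := by
    intro g
    obtain ⟨i, hi, h, hh, hgi⟩ := hG' g⁻¹
    exact ⟨h⁻¹, inv_mem hh, i⁻¹, inv_mem hi, by rw [← mul_inv_rev, ← hgi, inv_inv]⟩
  have hI : ∀ i ∈ SetLike.coe (Subgroup.zpowers σ), ∀ j ∈ SetLike.coe (Subgroup.zpowers σ),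
      Commute i j := by
    rintro _ ⟨i, rfl⟩ _ ⟨j, rfl⟩
    exact Commute.zpow_zpow_self σ i j
  obtain ⟨hlen, χ, hχ⟩ := Subgroup.exists_equiv_sameCosetImage hI hG hG'
    (m := U.length) (n := V.length)
    (a := fun i => MulAction.stabilizer _ (tailValue U x i))
    (b := fun i => MulAction.stabilizer _ (tailValue V x i))
    (stabilizer_le_stabilizer_tailValue U x) (stabilizer_le_stabilizer_tailValue V x)
    (stabilizer_tailValue_zero hUx) (stabilizer_tailValue_zero hVx)
    (by rw [tailValue_length]) (by rw [tailValue_length])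
    (fun _ hi => stabilizer_tailValue_covBy RatFunc.adjoin_X_eq_top htt hUx hU.1 hi)
    (fun _ hi => stabilizer_tailValue_covBy RatFunc.adjoin_X_eq_top htt hVx hV.1 hi)
  refine ⟨hlen, χ, fun i => monPermIso_of_sameImage ?_⟩
  exact (sameImage_stabilizer_tailValue RatFunc.adjoin_X_eq_top htt hUx hU.1 i.2).symm.trans
    ((hχ i).trans (sameImage_stabilizer_tailValue RatFunc.adjoin_X_eq_top htt hVx hV.1 (χ i).2))
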